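/- Let T_s < T_l be real numbers and let β ∈ (0, 1) be a real number. Then the rational interpolation factor α_rat(T_f) = (T_f − T_s) / (β·(T_f − T_l) + T_l − T_s) is strictly concave on the interval [T_s, T_l]. -/

import Mathlib

/-- The rational interpolation factor with `β ∈ (0,1)` is strictly concave on `[T_s, T_l]`. -/
theorem rational_interpolation_factor_strictConcave
    (Ts Tl β : ℝ) (hsl : Ts < Tl) (hβ : β ∈ Set.Ioo (0 : ℝ) 1) :
    StrictConcaveOn ℝ (Set.Icc Ts Tl)
      (fun Tf => (Tf - Ts) / (β * (Tf - Tl) + Tl - Ts)) := by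
  obtain ⟨hβ0, hβ1⟩ := hβ
  have hc : 0 < (1 - β) * (Tl - Ts) := mul_pos (by linarith) (by linarith)
  have hpos : ∀ z ∈ Set.Icc Ts Tl, 0 < β * (z - Tl) + Tl - Ts := fun z hz => by
    have := mul_nonneg hβ0.le (sub_nonneg.2 hz.1)
    linarith
  refine ⟨convex_Icc Ts Tl, fun x hx y hy hxy a b ha hb hab => ?_⟩
  have hDx := hpos x hx
  have hDy := hpos y hy
  have hDm := hpos _ (convex_Icc Ts Tl hx hy ha.le hb.le hab)
  simp only [smul_eq_mul] at hDm ⊢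
  obtain rfl : b = 1 - a := by linarith
  have hgap : 0 < (1 - β) * (Tl - Ts) * β * a * (1 - a) * (x - y) ^ 2 /
      ((β * (x - Tl) + Tl - Ts) * (β * (y - Tl) + Tl - Ts) *
        (β * (a * x + (1 - a) * y - Tl) + Tl - Ts)) := by
    have := sq_pos_of_ne_zero (sub_ne_zero.2 hxy)
    positivity
  rw [← sub_pos]
  refine hgap.trans_eq (Eq.symm ?_)
  have hx0 := hDx.ne'
  have hy0 := hDy.ne'
  have hm0 := hDm.ne'
  rw [← mul_div_assoc, ← mul_div_assoc, div_add_div _ _ hx0 hy0,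
    div_sub_div _ _ hm0 (mul_ne_zero hx0 hy0),
    div_eq_div_iff (mul_ne_zero hm0 (mul_ne_zero hx0 hy0)) (mul_ne_zero (mul_ne_zero hx0 hy0) hm0)]
  ring
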